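/- arXiv:2604.13356 — 6 statements merged into one kernel-verified Lean document; each statement's English description precedes it below -/
import Mathlib

section
/- For every index i and every t ≥ 0, the solver capability satisfies s_i(t) ∈ [0,1]; that is, the hypercube [0,1]^n is forward-invariant for the solver variables of the PST dynamics. -/
open Filter Topology

theorem stmt_0
    (n : ℕ) (hn : 1 ≤ n) (α β : ℝ) (hα : 0 < α) (hβ : 0 < β)
    (s : Fin n → ℝ → ℝ) (v : ℝ → ℝ)
    (hs : ∀ i, ∀ t ≥ (0:ℝ),
      HasDerivAt (s i) (α * (1 - s i t) * max (v t - s i t) 0) t)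
    (hv : ∀ t ≥ (0:ℝ),
      HasDerivAt v (β * (1 - v t) * ⨆ i, s i t) t)
    (hs0 : ∀ i, s i 0 ∈ Set.Icc (0:ℝ) 1)
    (hv0 : v 0 ∈ Set.Icc (0:ℝ) 1)
    : ∀ i, ∀ t ≥ (0:ℝ), s i t ∈ Set.Icc (0:ℝ) 1 := by
  intro i
  have hsc : ContinuousOn (s i) (Set.Ici 0) := fun t ht =>
    (hs i t ht).continuousAt.continuousWithinAt
  have hvc : ContinuousOn v (Set.Ici 0) := fun t ht =>
    (hv t ht).continuousAt.continuousWithinAt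
  have hm : Continuous (fun t : ℝ => max t 0) := by fun_prop
  have hsc' : Continuous (fun t => s i (max t 0)) :=
    hsc.comp_continuous hm (fun t => Set.mem_Ici.2 (le_max_right _ _))
  have hvc' : Continuous (fun t => v (max t 0)) :=
    hvc.comp_continuous hm (fun t => Set.mem_Ici.2 (le_max_right _ _))
  have hg : Continuous (fun t => max (v (max t 0) - s i (max t 0)) 0) :=
    (hvc'.sub hsc').max continuous_const
  have hG : ∀ t, HasDerivAt (fun t => ∫ x in (0:ℝ)..t, max (v (max x 0) - s i (max x 0)) 0)
      (max (v (max t 0) - s i (max t 0)) 0) t := fun t =>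
    (hg.integral_hasStrictDerivAt 0 t).hasDerivAt
  generalize (fun t => ∫ x in (0:ℝ)..t, max (v (max x 0) - s i (max x 0)) 0) = G at hG
  have hw : ∀ t ≥ (0:ℝ), HasDerivAt (fun t => (1 - s i t) * Real.exp (α * G t)) 0 t := by
    intro t ht
    have h1 := hG t
    rw [max_eq_left ht] at h1
    refine HasDerivAt.congr_deriv (((hs i t ht).const_sub 1).mul (h1.const_mul α).exp) ?_
    ring
  have hle : ∀ t ≥ (0:ℝ), s i t ≤ 1 := by
    intro t ht
    have h := constant_of_has_deriv_right_zero (a := 0) (b := t)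
      (f := fun t => (1 - s i t) * Real.exp (α * G t))
      (fun x hx => (hw x hx.1).continuousAt.continuousWithinAt)
      (fun x hx => (hw x hx.1).hasDerivWithinAt) t ⟨ht, le_rfl⟩
    have h0 : 0 ≤ (1 - s i 0) * Real.exp (α * G 0) :=
      mul_nonneg (by linarith [(hs0 i).2]) (Real.exp_pos _).le
    rw [← h] at h0
    have := nonneg_of_mul_nonneg_left h0 (Real.exp_pos _)
    linarith
  have hmono : MonotoneOn (s i) (Set.Ici 0) := by
    apply monotoneOn_of_deriv_nonneg (convex_Ici 0) hsc
    · intro x hx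
      exact (hs i x (interior_subset hx)).differentiableAt.differentiableWithinAt
    · intro x hx
      have hx' : x ≥ 0 := interior_subset hx
      rw [(hs i x hx').deriv]
      exact mul_nonneg (mul_nonneg hα.le (by linarith [hle x hx'])) (le_max_right _ _)
  intro t ht
  exact ⟨(hs0 i).1.trans (hmono Set.self_mem_Ici ht ht), hle t ht⟩
end

section
/- For every index i, the function t ↦ s_i(t) is monotone non-decreasing on [0,∞); equivalently, for all 0 ≤ t₁ ≤ t₂ one has s_i(t₁) ≤ s_i(t₂). -/
open Filter Topology

theorem stmt_2
    (n : ℕ) (hn : 1 ≤ n) (α β : ℝ) (hα : 0 < α) (hβ : 0 < β)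
    (s : Fin n → ℝ → ℝ) (v : ℝ → ℝ)
    (hs : ∀ i, ∀ t ≥ (0:ℝ),
      HasDerivAt (s i) (α * (1 - s i t) * max (v t - s i t) 0) t)
    (hv : ∀ t ≥ (0:ℝ),
      HasDerivAt v (β * (1 - v t) * ⨆ i, s i t) t)
    (hs0 : ∀ i, s i 0 ∈ Set.Icc (0:ℝ) 1)
    (hv0 : v 0 ∈ Set.Icc (0:ℝ) 1)
    : ∀ i, ∀ t₁ t₂ : ℝ, 0 ≤ t₁ → t₁ ≤ t₂ → s i t₁ ≤ s i t₂ := by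
  intro i t₁ t₂ h1 h12
  have key : ∀ T ≥ (0:ℝ), s i T ≤ 1 := by
    intro T hT
    have h : ∀ ε > (0:ℝ), s i T ≤ 1 + ε * (T + 1) := by
      intro ε hε
      refine image_le_of_deriv_right_lt_deriv_boundary' (f := s i) (a := 0) (b := T)
        (f' := fun t => α * (1 - s i t) * max (v t - s i t) 0)
        (B := fun t => 1 + ε * (t + 1)) (B' := fun _ => ε)
        (fun t ht => (hs i t ht.1).continuousAt.continuousWithinAt)
        (fun t ht => (hs i t ht.1).hasDerivWithinAt) ?_ (by fun_prop) ?_ ?_ ⟨hT, le_rfl⟩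
      · have := (hs0 i).2
        linarith
      · intro t _
        have : HasDerivAt (fun t : ℝ => 1 + ε * (t + 1)) (ε * 1) t :=
          (((hasDerivAt_id t).add_const 1).const_mul ε).const_add 1
        rw [mul_one] at this
        exact this.hasDerivWithinAt
      · intro t ht hst
        have h2 : 0 < ε * (t + 1) := mul_pos hε (by linarith [ht.1])
        have h3 : α * (1 - s i t) ≤ 0 :=
          mul_nonpos_of_nonneg_of_nonpos hα.le (by linarith)
        have := mul_nonpos_of_nonpos_of_nonneg h3 (le_max_right (v t - s i t) 0)
        linarith
    refine le_of_forall_pos_le_add fun δ hδ => ?_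
    have h4 := h (δ / (T + 1)) (by positivity)
    rwa [div_mul_cancel₀ _ (by positivity)] at h4
  have hm : MonotoneOn (s i) (Set.Ici 0) := by
    refine monotoneOn_of_hasDerivWithinAt_nonneg (convex_Ici 0)
      (f' := fun t => α * (1 - s i t) * max (v t - s i t) 0)
      (fun t ht => (hs i t ht).continuousAt.continuousWithinAt)
      (fun t ht => (hs i t (interior_subset ht)).hasDerivWithinAt) ?_
    intro t ht
    have := key t (interior_subset ht)
    exact mul_nonneg (mul_nonneg hα.le (by linarith)) (le_max_right _ _)
  exact hm h1 (h1.trans h12) h12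
end

section
/- The function t ↦ v(t) is monotone non-decreasing on [0,∞); equivalently, for all 0 ≤ t₁ ≤ t₂ one has v(t₁) ≤ v(t₂). -/
open Filter Topology

lemma aux_cont (f f' : ℝ → ℝ) (h : ∀ t ≥ (0:ℝ), HasDerivAt f (f' t) t) :
    Continuous (fun t => f (max t 0)) := by
  rw [continuous_iff_continuousAt]
  intro t
  have h1 : ContinuousAt f (max t 0) := (h _ (le_max_right _ _)).continuousAt
  have h2 : ContinuousAt (fun t : ℝ => max t 0) t := by fun_prop
  exact ContinuousAt.comp (f := fun t : ℝ => max t 0) h1 h2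

lemma aux_nonneg (y c : ℝ → ℝ) (hc : Continuous (fun t => c (max t 0)))
    (hy : ∀ t ≥ (0:ℝ), HasDerivAt y (-(c t * y t)) t) (h0 : 0 ≤ y 0) :
    ∀ t ≥ (0:ℝ), 0 ≤ y t := by
  intro t ht
  have hC : ∀ x, HasDerivAt (fun u => ∫ r in (0:ℝ)..u, c (max r 0)) (c (max x 0)) x := fun x =>
    intervalIntegral.integral_hasDerivAt_right (hc.intervalIntegrable _ _)
      (hc.stronglyMeasurableAtFilter _ _) hc.continuousAt
  set C := fun u => ∫ r in (0:ℝ)..u, c (max r 0) with hCdef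
  have hg : ∀ x ≥ (0:ℝ), HasDerivAt (fun u => y u * Real.exp (C u)) 0 x := by
    intro x hx
    have h := (hy x hx).mul (hC x).exp
    rw [max_eq_left hx] at h
    refine HasDerivAt.congr_deriv h ?_
    ring
  have hconst := constant_of_has_deriv_right_zero (f := fun u => y u * Real.exp (C u))
    (a := 0) (b := t)
    (fun x hx => (hg x hx.1).continuousAt.continuousWithinAt)
    (fun x hx => (hg x hx.1).hasDerivWithinAt) t ⟨ht, le_refl t⟩
  have h1 : 0 ≤ y t * Real.exp (C t) := by
    rw [hconst]
    positivity
  exact nonneg_of_mul_nonneg_left h1 (Real.exp_pos _)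

lemma aux_mono (f f' : ℝ → ℝ) (h : ∀ t ≥ (0:ℝ), HasDerivAt f (f' t) t)
    (h0 : ∀ t ≥ (0:ℝ), 0 ≤ f' t) : MonotoneOn f (Set.Ici 0) := by
  apply monotoneOn_of_hasDerivWithinAt_nonneg (f' := f') (convex_Ici 0)
  · exact fun x hx => (h x hx).continuousAt.continuousWithinAt
  · exact fun x hx => (h x (interior_subset hx)).hasDerivWithinAt
  · exact fun x hx => h0 x (interior_subset hx)

theorem stmt_3
    (n : ℕ) (hn : 1 ≤ n) (α β : ℝ) (hα : 0 < α) (hβ : 0 < β)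
    (s : Fin n → ℝ → ℝ) (v : ℝ → ℝ)
    (hs : ∀ i, ∀ t ≥ (0:ℝ),
      HasDerivAt (s i) (α * (1 - s i t) * max (v t - s i t) 0) t)
    (hv : ∀ t ≥ (0:ℝ),
      HasDerivAt v (β * (1 - v t) * ⨆ i, s i t) t)
    (hs0 : ∀ i, s i 0 ∈ Set.Icc (0:ℝ) 1)
    (hv0 : v 0 ∈ Set.Icc (0:ℝ) 1)
    : ∀ t₁ t₂ : ℝ, 0 ≤ t₁ → t₁ ≤ t₂ → v t₁ ≤ v t₂ := by
  have hsc := fun i => aux_cont _ _ (hs i)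
  have hvc := aux_cont _ _ hv
  haveI : Nonempty (Fin n) := ⟨⟨0, hn⟩⟩
  have hSc : Continuous (fun t => ⨆ i, s i (max t 0)) := by
    simp_rw [← Finset.sup'_univ_eq_ciSup]
    exact Continuous.finset_sup'_apply _ (fun i _ => hsc i)
  have hs1 : ∀ i, ∀ t ≥ (0:ℝ), 0 ≤ 1 - s i t := by
    intro i
    apply aux_nonneg (fun t => 1 - s i t) (fun t => α * max (v t - s i t) 0)
    · exact continuous_const.mul ((hvc.sub (hsc i)).max continuous_const)
    · intro t ht
      refine ((hs i t ht).const_sub 1).congr_deriv ?_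
      ring
    · linarith [(hs0 i).2]
  have hv1 : ∀ t ≥ (0:ℝ), 0 ≤ 1 - v t := by
    apply aux_nonneg (fun t => 1 - v t) (fun t => β * ⨆ i, s i t)
    · exact continuous_const.mul hSc
    · intro t ht
      refine ((hv t ht).const_sub 1).congr_deriv ?_
      ring
    · linarith [hv0.2]
  have hsn : ∀ i, ∀ t ≥ (0:ℝ), 0 ≤ s i t := by
    intro i t ht
    refine (hs0 i).1.trans (aux_mono _ _ (hs i) ?_ (Set.mem_Ici.2 le_rfl) ht ht)
    intro u hu
    exact mul_nonneg (mul_nonneg hα.le (hs1 i u hu)) (le_max_right _ _)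
  intro t₁ t₂ h1 h2
  refine aux_mono _ _ hv ?_ h1 (h1.trans h2) h2
  intro u hu
  exact mul_nonneg (mul_nonneg hβ.le (hv1 u hu)) (Real.iSup_nonneg fun i => hsn i u hu)
end

section
/- For every index i, the limit s_i* := lim_{t→∞} s_i(t) exists as a real number, and it satisfies s_i(0) ≤ s_i* ≤ 1. -/
open Filter Topology

theorem stmt_4
    (n : ℕ) (hn : 1 ≤ n) (α β : ℝ) (hα : 0 < α) (hβ : 0 < β)
    (s : Fin n → ℝ → ℝ) (v : ℝ → ℝ)
    (hs : ∀ i, ∀ t ≥ (0:ℝ),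
      HasDerivAt (s i) (α * (1 - s i t) * max (v t - s i t) 0) t)
    (hv : ∀ t ≥ (0:ℝ),
      HasDerivAt v (β * (1 - v t) * ⨆ i, s i t) t)
    (hs0 : ∀ i, s i 0 ∈ Set.Icc (0:ℝ) 1)
    (hv0 : v 0 ∈ Set.Icc (0:ℝ) 1)
    : ∀ i, ∃ sStar : ℝ, Tendsto (s i) atTop (𝓝 sStar) ∧ s i 0 ≤ sStar ∧ sStar ≤ 1 := by
  intro i
  have hcont : ContinuousOn (s i) (Set.Ici 0) := fun t ht =>
    (hs i t ht).continuousAt.continuousWithinAt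
  have hlin : ∀ ε > (0:ℝ), ∀ T ≥ (0:ℝ), s i T ≤ 1 + ε * T := by
    intro ε hε T hT
    refine image_le_of_deriv_right_lt_deriv_boundary (f := s i)
      (f' := fun t => α * (1 - s i t) * max (v t - s i t) 0) (a := 0) (b := T)
      (B := fun t => 1 + ε * t) (B' := fun _ => ε)
      (hcont.mono Set.Icc_subset_Ici_self)
      (fun t ht => (hs i t ht.1).hasDerivWithinAt) ?_ ?_ ?_ ⟨hT, le_refl T⟩
    · simpa using (hs0 i).2
    · intro t
      simpa using ((hasDerivAt_id t).const_mul ε).const_add 1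
    · intro t ht h
      have h1 : 0 ≤ ε * t := mul_nonneg hε.le ht.1
      have h2 : α * (1 - s i t) ≤ 0 :=
        mul_nonpos_of_nonneg_of_nonpos hα.le (by linarith)
      exact lt_of_le_of_lt (mul_nonpos_of_nonpos_of_nonneg h2 (le_max_right _ _)) hε
  have hle : ∀ T ≥ (0:ℝ), s i T ≤ 1 := by
    intro T hT
    refine le_of_forall_pos_le_add fun δ hδ => ?_
    have h := hlin (δ / (T + 1)) (by positivity) T hT
    have h2 : δ / (T + 1) * T ≤ δ := by
      rw [div_mul_eq_mul_div, div_le_iff₀ (by positivity)]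
      nlinarith
    linarith
  have hmono : MonotoneOn (s i) (Set.Ici 0) := by
    refine monotoneOn_of_deriv_nonneg (convex_Ici 0) hcont ?_ ?_
    · intro t ht
      rw [interior_Ici] at ht
      exact (hs i t (le_of_lt ht)).differentiableAt.differentiableWithinAt
    · intro t ht
      rw [interior_Ici] at ht
      have ht' : (0:ℝ) ≤ t := le_of_lt ht
      rw [(hs i t ht').deriv]
      exact mul_nonneg (mul_nonneg hα.le (by linarith [hle t ht'])) (le_max_right _ _)
  have hm : Monotone (fun t => s i (max t 0)) := fun a b hab =>
    hmono (le_max_right a 0) (le_max_right b 0) (max_le_max_right 0 hab)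
  have hb : BddAbove (Set.range fun t => s i (max t 0)) := by
    refine ⟨1, ?_⟩
    rintro _ ⟨t, rfl⟩
    exact hle _ (le_max_right t 0)
  refine ⟨⨆ t, s i (max t 0), ?_, ?_, ?_⟩
  · refine (tendsto_atTop_ciSup hm hb).congr' ?_
    filter_upwards [eventually_ge_atTop (0:ℝ)] with t ht
    rw [max_eq_left ht]
  · simpa using le_ciSup hb 0
  · exact ciSup_le fun t => hle _ (le_max_right t 0)
end

section
/- (Convergence of PST dynamics, main claim.) Suppose v(t) converges to a limit v* as t → ∞ and, for a fixed index i, s_i(t) converges to a limit s_i* as t → ∞. If s_i(0) < v*, then s_i* = v*; that is, at convergence no solver remains strictly below the limiting evaluation signal unless it started at or above it. -/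
open Filter Topology

lemma barrier (f f' : ℝ → ℝ) (c : ℝ) (hf : ∀ t ≥ (0:ℝ), HasDerivAt f (f' t) t)
    (h0 : f 0 ≤ c) (h : ∀ t ≥ (0:ℝ), c < f t → f' t ≤ 0) : ∀ t ≥ (0:ℝ), f t ≤ c := by
  intro t ht
  by_contra! hc
  have hcont : ContinuousOn f (Set.Icc 0 t) := fun x hx =>
    (hf x hx.1).continuousAt.continuousWithinAt
  have hcl : IsClosed (Set.Icc 0 t ∩ f ⁻¹' Set.Iic c) :=
    hcont.preimage_isClosed_of_isClosed isClosed_Icc isClosed_Iic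
  have hcomp : IsCompact (Set.Icc 0 t ∩ f ⁻¹' Set.Iic c) :=
    isCompact_Icc.of_isClosed_subset hcl Set.inter_subset_left
  obtain ⟨a, ⟨⟨ha0, hat⟩, hac⟩, hmax⟩ :=
    hcomp.exists_isGreatest ⟨0, ⟨le_refl _, ht⟩, h0⟩
  have hanti : AntitoneOn f (Set.Icc a t) := by
    apply antitoneOn_of_deriv_nonpos (convex_Icc a t)
    · exact hcont.mono (Set.Icc_subset_Icc_left ha0)
    · intro x hx
      rw [interior_Icc] at hx
      exact (hf x (ha0.trans hx.1.le)).differentiableAt.differentiableWithinAt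
    · intro x hx
      rw [interior_Icc] at hx
      have hx0 : 0 ≤ x := ha0.trans hx.1.le
      rw [(hf x hx0).deriv]
      apply h x hx0
      by_contra! hle
      exact absurd (hmax ⟨⟨hx0, hx.2.le⟩, hle⟩) (not_le.mpr hx.1)
  have h1 := hanti ⟨le_refl _, hat⟩ ⟨hat, le_refl _⟩ hat
  have h2 : f a ≤ c := hac
  linarith

lemma mono_aux (f f' : ℝ → ℝ) (hf : ∀ t ≥ (0:ℝ), HasDerivAt f (f' t) t)
    (h : ∀ t ≥ (0:ℝ), 0 ≤ f' t) : MonotoneOn f (Set.Ici 0) := by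
  apply monotoneOn_of_deriv_nonneg (convex_Ici 0)
  · exact fun x hx => (hf x hx).continuousAt.continuousWithinAt
  · intro x hx
    exact (hf x (interior_subset hx)).differentiableAt.differentiableWithinAt
  · intro x hx
    have hx0 : (0:ℝ) ≤ x := interior_subset hx
    rw [(hf x hx0).deriv]
    exact h x hx0

theorem stmt_6
    (n : ℕ) (hn : 1 ≤ n) (α β : ℝ) (hα : 0 < α) (hβ : 0 < β)
    (s : Fin n → ℝ → ℝ) (v : ℝ → ℝ)
    (hs : ∀ i, ∀ t ≥ (0:ℝ),
      HasDerivAt (s i) (α * (1 - s i t) * max (v t - s i t) 0) t)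
    (hv : ∀ t ≥ (0:ℝ),
      HasDerivAt v (β * (1 - v t) * ⨆ i, s i t) t)
    (hs0 : ∀ i, s i 0 ∈ Set.Icc (0:ℝ) 1)
    (hv0 : v 0 ∈ Set.Icc (0:ℝ) 1)
    (i : Fin n) (sStar vStar : ℝ)
    (hsl : Tendsto (s i) atTop (𝓝 sStar))
    (hvl : Tendsto v atTop (𝓝 vStar))
    (hlt : s i 0 < vStar)
    : sStar = vStar := by
  have s1 : ∀ j, ∀ t ≥ (0:ℝ), s j t ≤ 1 := by
    intro j
    apply barrier (s j) _ 1 (hs j) (hs0 j).2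
    intro t _ h
    exact mul_nonpos_of_nonpos_of_nonneg
      (mul_nonpos_of_nonneg_of_nonpos hα.le (by linarith)) (le_max_right _ _)
  have smono : ∀ j, MonotoneOn (s j) (Set.Ici 0) := by
    intro j
    apply mono_aux (s j) _ (hs j)
    intro t ht
    have := s1 j t ht
    exact mul_nonneg (mul_nonneg hα.le (by linarith)) (le_max_right _ _)
  have sup0 : ∀ t ≥ (0:ℝ), 0 ≤ ⨆ i, s i t := by
    intro t ht
    apply Real.iSup_nonneg
    intro j
    exact (hs0 j).1.trans (smono j (Set.mem_Ici.mpr le_rfl) ht ht)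
  have v1 : ∀ t ≥ (0:ℝ), v t ≤ 1 := by
    apply barrier v _ 1 hv hv0.2
    intro t ht h
    exact mul_nonpos_of_nonpos_of_nonneg
      (mul_nonpos_of_nonneg_of_nonpos hβ.le (by linarith)) (sup0 t ht)
  have vmono : MonotoneOn v (Set.Ici 0) := by
    apply mono_aux v _ hv
    intro t ht
    have := v1 t ht
    exact mul_nonneg (mul_nonneg hβ.le (by linarith)) (sup0 t ht)
  have vle : ∀ t ≥ (0:ℝ), v t ≤ vStar := by
    intro t ht
    apply ge_of_tendsto hvl
    filter_upwards [eventually_ge_atTop t] with u hu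
    exact vmono ht (Set.mem_Ici.mpr (ht.le.trans hu)) hu
  have sle : ∀ t ≥ (0:ℝ), s i t ≤ vStar := by
    apply barrier (s i) _ vStar (hs i) hlt.le
    intro t ht h
    have := vle t ht
    rw [max_eq_right (by linarith)]
    simp
  have hS : sStar ≤ vStar := by
    apply le_of_tendsto hsl
    filter_upwards [eventually_ge_atTop 0] with u hu
    exact sle u hu
  have hV : vStar ≤ 1 := by
    apply le_of_tendsto hvl
    filter_upwards [eventually_ge_atTop 0] with u hu
    exact v1 u hu
  by_contra hne
  have hlt' : sStar < vStar := lt_of_le_of_ne hS hne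
  set L := α * (1 - sStar) * max (vStar - sStar) 0 with hL
  have hLpos : 0 < L :=
    mul_pos (mul_pos hα (by linarith)) (lt_max_of_lt_left (by linarith))
  have hder : Tendsto (fun t => α * (1 - s i t) * max (v t - s i t) 0) atTop (𝓝 L) :=
    (tendsto_const_nhds.mul (tendsto_const_nhds.sub hsl)).mul
      ((hvl.sub hsl).max tendsto_const_nhds)
  have hev := hder.eventually (lt_mem_nhds (half_lt_self hLpos))
  obtain ⟨T, hT⟩ := eventually_atTop.mp hev
  have hdiff : Tendsto (fun t => s i (t + 1) - s i t) atTop (𝓝 (sStar - sStar)) :=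
    (hsl.comp (tendsto_atTop_add_const_right _ 1 tendsto_id)).sub hsl
  have hge : L / 2 ≤ sStar - sStar := by
    apply ge_of_tendsto hdiff
    filter_upwards [eventually_ge_atTop 0, eventually_ge_atTop T] with u hu huT
    obtain ⟨x, hx, hxe⟩ := exists_hasDerivAt_eq_slope (s i)
      (fun t => α * (1 - s i t) * max (v t - s i t) 0) (show u < u + 1 by linarith)
      (fun x hx => (hs i x (hu.trans hx.1)).continuousAt.continuousWithinAt)
      (fun x hx => hs i x (hu.trans hx.1.le))
    have h3 := hT x (huT.trans hx.1.le)
    rw [add_sub_cancel_left, div_one] at hxe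
    linarith
  linarith
end

section
/- (Corollary of the convergence theorem.) Suppose that for every index i the limit s_i* := lim_{t→∞} s_i(t) exists and that v* := lim_{t→∞} v(t) exists. Then for every index i, s_i* ≥ v*; that is, every solver's limiting capability is at least the limiting aggregated evaluation signal. -/
open Filter Topology

theorem barrier_aux (f f' : ℝ → ℝ) (c : ℝ) (hf : ∀ t ≥ (0:ℝ), HasDerivAt f (f' t) t)
    (h0 : f 0 ≤ c) (hb : ∀ t ≥ (0:ℝ), c < f t → f' t ≤ 0) : ∀ t ≥ (0:ℝ), f t ≤ c := by
  intro t ht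
  have key : ∀ ε > (0:ℝ), f t ≤ c + ε * (t + 1) := by
    intro ε hε
    refine image_le_of_deriv_right_lt_deriv_boundary (f := f) (f' := f') (a := 0) (b := t)
      (B := fun x => c + ε * (x + 1)) (B' := fun _ => ε) ?_ ?_ ?_ ?_ ?_ ⟨ht, le_refl t⟩
    · exact fun x hx => (hf x hx.1).continuousAt.continuousWithinAt
    · exact fun x hx => (hf x hx.1).hasDerivWithinAt
    · linarith
    · intro x
      simpa using (((hasDerivAt_id x).add_const 1).const_mul ε).const_add c
    · intro x hx h
      have h1 : 0 < ε * (x + 1) := mul_pos hε (by linarith [hx.1])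
      have := hb x hx.1 (by rw [h]; linarith)
      linarith
  by_contra h
  push Not at h
  have h2 := key ((f t - c) / (2 * (t + 1))) (div_pos (by linarith) (by linarith))
  have h3 : (f t - c) / (2 * (t + 1)) * (t + 1) = (f t - c) / 2 := by
    have : t + 1 ≠ 0 := by linarith
    field_simp
  linarith

theorem stmt_9
    (n : ℕ) (hn : 1 ≤ n) (α β : ℝ) (hα : 0 < α) (hβ : 0 < β)
    (s : Fin n → ℝ → ℝ) (v : ℝ → ℝ)
    (hs : ∀ i, ∀ t ≥ (0:ℝ),
      HasDerivAt (s i) (α * (1 - s i t) * max (v t - s i t) 0) t)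
    (hv : ∀ t ≥ (0:ℝ),
      HasDerivAt v (β * (1 - v t) * ⨆ i, s i t) t)
    (hs0 : ∀ i, s i 0 ∈ Set.Icc (0:ℝ) 1)
    (hv0 : v 0 ∈ Set.Icc (0:ℝ) 1)
    (sStar : Fin n → ℝ) (vStar : ℝ)
    (hsl : ∀ i, Tendsto (s i) atTop (𝓝 (sStar i)))
    (hvl : Tendsto v atTop (𝓝 vStar))
    : ∀ i, vStar ≤ sStar i := by
  have hpos : ∀ i, ∀ t ≥ (0:ℝ), 0 ≤ s i t := by
    intro i t ht
    have := barrier_aux (fun t => - s i t) _ 0 (fun t ht => (hs i t ht).neg)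
      (by simpa using (hs0 i).1) (by
        intro t ht h
        have : 0 ≤ α * (1 - s i t) * max (v t - s i t) 0 :=
          mul_nonneg (mul_nonneg hα.le (by linarith)) (le_max_right _ _)
        linarith) t ht
    linarith
  have hv1 : ∀ t ≥ (0:ℝ), v t ≤ 1 := by
    refine barrier_aux v _ 1 hv hv0.2 ?_
    intro t ht h
    have h1 : 0 ≤ ⨆ i, s i t := Real.iSup_nonneg (fun i => hpos i t ht)
    exact mul_nonpos_of_nonpos_of_nonneg
      (mul_nonpos_of_nonneg_of_nonpos hβ.le (by linarith)) h1
  have hvs : vStar ≤ 1 :=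
    le_of_tendsto hvl ((eventually_ge_atTop 0).mono hv1)
  intro i
  by_contra hlt
  push Not at hlt
  have hL : 0 < α * (1 - sStar i) * max (vStar - sStar i) 0 :=
    mul_pos (mul_pos hα (by linarith)) (lt_max_of_lt_left (by linarith))
  have hlim : Tendsto (fun t => α * (1 - s i t) * max (v t - s i t) 0) atTop
      (𝓝 (α * (1 - sStar i) * max (vStar - sStar i) 0)) :=
    (((hsl i).const_sub 1).const_mul α).mul ((hvl.sub (hsl i)).max tendsto_const_nhds)
  set L := α * (1 - sStar i) * max (vStar - sStar i) 0 with hLdef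
  obtain ⟨T, hT⟩ := eventually_atTop.1 (hlim.eventually (lt_mem_nhds (half_lt_self hL)))
  have hinc : ∀ t ≥ max T 0, L / 2 ≤ s i (t + 1) - s i t := by
    intro t ht
    have htT := le_trans (le_max_left _ _) ht
    have ht0 := le_trans (le_max_right _ _) ht
    obtain ⟨c, hc, he⟩ := exists_hasDerivAt_eq_slope (s i) _ (show t < t + 1 by linarith)
      (fun x hx => (hs i x (by linarith [hx.1])).continuousAt.continuousWithinAt)
      (fun x hx => hs i x (by linarith [hx.1]))
    have := hT c (by linarith [hc.1])
    rw [show t + 1 - t = 1 by ring, div_one] at he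
    linarith
  have hz : Tendsto (fun t => s i (t + 1) - s i t) atTop (𝓝 (sStar i - sStar i)) :=
    ((hsl i).comp (tendsto_atTop_add_const_right _ 1 tendsto_id)).sub (hsl i)
  have := ge_of_tendsto hz ((eventually_ge_atTop _).mono hinc)
  linarith
end
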